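/- There exists a K-algebra homomorphism φ : R → End_K(ℕ → K) with φ(X) = L and φ(Y) = S, and for any such φ, the space ℕ → K endowed with the left R-module structure induced by φ (r • s := φ(r)(s)) is an injective left R-module. (This module is the module Y of formal series of the paper; note L ∘ S = id, so φ exists and is unique.) -/

import Mathlib

noncomputable section

/-- The defining relation `X * Y = 1` of the Jacobson algebra. -/
inductive JRel (K : Type*) [Field K] : FreeAlgebra K (Fin 2) → FreeAlgebra K (Fin 2) → Prop
  | rel : JRel K (FreeAlgebra.ι K 0 * FreeAlgebra.ι K 1) 1

/-- The Jacobson algebra `K⟨X, Y | XY = 1⟩`. -/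
abbrev Jacobson (K : Type*) [Field K] := RingQuot (JRel K)

variable (K : Type*) [Field K]

/-- The generator `X` of the Jacobson algebra. -/
def Xg : Jacobson K := RingQuot.mkAlgHom K (JRel K) (FreeAlgebra.ι K 0)

/-- The generator `Y` of the Jacobson algebra. -/
def Yg : Jacobson K := RingQuot.mkAlgHom K (JRel K) (FreeAlgebra.ι K 1)

/-- The loop `c = Y²X`. -/
def cJ : Jacobson K := Yg K ^ 2 * Xg K

/-- `F` is the set of irreducible polynomials `f ∈ K[x]` with `f(0) = -1`. -/
def FSet : Set (Polynomial K) := {f | Irreducible f ∧ f.eval 0 = -1}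

/-- The left-shift operator `(L s) n = s (n + 1)` on sequences. -/
def Lsh : (ℕ → K) →ₗ[K] (ℕ → K) where
  toFun s := fun n => s (n + 1)
  map_add' := by intros; rfl
  map_smul' := by intros; rfl

/-- The right-shift operator `(S s) 0 = 0`, `(S s) (n + 1) = s n` on sequences. -/
def Ssh : (ℕ → K) →ₗ[K] (ℕ → K) where
  toFun s := fun n => match n with | 0 => 0 | (k + 1) => s k
  map_add' := by
    intro a b; funext n; cases n <;> simp
  map_smul' := by
    intro m a; funext n; cases n <;> simp

/-- The left `R`-module structure on `ℕ → K` induced by a `K`-algebra homomorphism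
`φ : R → End_K(ℕ → K)`, namely `r • s := φ r s`. -/
def moduleOfHom (φ : Jacobson K →ₐ[K] Module.End K (ℕ → K)) :
    Module (Jacobson K) (ℕ → K) :=
  Module.compHom (ℕ → K) φ.toRingHom

theorem Xg_mul_Yg : Xg K * Yg K = 1 := by
  have h := RingQuot.mkAlgHom_rel K (JRel.rel (K := K))
  simpa [Xg, Yg] using h

theorem Jacobson_induction {P : Jacobson K → Prop} (hc : ∀ c : K, P (algebraMap K _ c))
    (hX : P (Xg K)) (hY : P (Yg K)) (hm : ∀ a b, P a → P b → P (a * b))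
    (ha : ∀ a b, P a → P b → P (a + b)) (r : Jacobson K) : P r := by
  obtain ⟨w, rfl⟩ := RingQuot.mkAlgHom_surjective K (JRel K) r
  induction w using FreeAlgebra.induction with
  | grade0 c => simpa using hc c
  | grade1 i =>
    fin_cases i
    · exact hX
    · exact hY
  | mul a b h1 h2 => rw [map_mul]; exact hm _ _ h1 h2
  | add a b h1 h2 => rw [map_add]; exact ha _ _ h1 h2

theorem Lsh_pow_apply (n : ℕ) (s : ℕ → K) : ((Lsh K) ^ n) s 0 = s n := by
  induction n generalizing s with
  | zero => rfl
  | succ n ih =>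
    rw [pow_succ, Module.End.mul_apply, ih]; rfl

/-- The map into sequences induced by a functional. -/
def serMap (l : Jacobson K →ₗ[K] K) : Jacobson K →ₗ[K] (ℕ → K) :=
  LinearMap.pi fun n => l ∘ₗ LinearMap.mulLeft K (Xg K ^ n)

theorem serMap_apply (l : Jacobson K →ₗ[K] K) (x : Jacobson K) (n : ℕ) :
    serMap K l x n = l (Xg K ^ n * x) := rfl

theorem serMap_mul (φ : Jacobson K →ₐ[K] Module.End K (ℕ → K)) (hX : φ (Xg K) = Lsh K)
    (hY : φ (Yg K) = Ssh K) (l : Jacobson K →ₗ[K] K) (hl : ∀ x, l (Yg K * x) = 0)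
    (r : Jacobson K) : ∀ x, serMap K l (r * x) = φ r (serMap K l x) := by
  induction r using Jacobson_induction with
  | hc c =>
    intro x
    rw [← Algebra.smul_def, map_smul, AlgHom.commutes]; rfl
  | hX =>
    intro x
    rw [hX]; funext n
    change l (Xg K ^ n * (Xg K * x)) = l (Xg K ^ (n + 1) * x)
    rw [pow_succ, mul_assoc]
  | hY =>
    intro x
    rw [hY]; funext n
    cases n with
    | zero => rw [serMap_apply, pow_zero, one_mul, hl]; rfl
    | succ n =>
      change l (Xg K ^ (n + 1) * (Yg K * x)) = l (Xg K ^ n * x)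
      rw [pow_succ, mul_assoc, ← mul_assoc (Xg K), Xg_mul_Yg, one_mul]
  | hm a b ha hb => intro x; rw [mul_assoc, ha, hb, map_mul]; rfl
  | ha a b ha hb => intro x; rw [add_mul, map_add, ha, hb, map_add]; rfl

theorem existsHom :
    ∃ φ : Jacobson K →ₐ[K] Module.End K (ℕ → K), φ (Xg K) = Lsh K ∧ φ (Yg K) = Ssh K := by
  refine ⟨RingQuot.liftAlgHom K ⟨FreeAlgebra.lift K ![Lsh K, Ssh K], ?_⟩, ?_, ?_⟩
  · rintro _ _ ⟨⟩
    simp only [map_mul, FreeAlgebra.lift_ι_apply, map_one]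
    rfl
  · simp [Xg]
  · simp [Yg]

theorem baer_series (φ : Jacobson K →ₐ[K] Module.End K (ℕ → K)) (hX : φ (Xg K) = Lsh K)
    (hY : φ (Yg K) = Ssh K) :
    letI := moduleOfHom K φ
    Module.Baer (Jacobson K) (ℕ → K) := by
  letI := moduleOfHom K φ
  intro I g
  have hs : ∀ (r : Jacobson K) (s : ℕ → K), r • s = φ r s := fun _ _ => rfl
  let l0 : (I.restrictScalars K) →ₗ[K] K :=
    { toFun := fun x => g ⟨x.1, x.2⟩ 0
      map_add' := fun x y => congrFun (g.map_add ⟨x.1, x.2⟩ ⟨y.1, y.2⟩) 0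
      map_smul' := fun c x => by
        have h := g.map_smul (algebraMap K (Jacobson K) c) ⟨x.1, x.2⟩
        rw [hs, AlgHom.commutes] at h
        have h2 := congrFun h 0
        have e : (⟨(c • x).1, (c • x).2⟩ : I) = algebraMap K (Jacobson K) c • ⟨x.1, x.2⟩ := by
          apply Subtype.ext
          exact Algebra.smul_def c x.1
        rw [e]
        exact h2 }
  obtain ⟨l1, hl1⟩ := LinearMap.exists_extend l0
  have hl1' : ∀ x (hx : x ∈ I), l1 x = g ⟨x, hx⟩ 0 := fun x hx =>
    LinearMap.congr_fun hl1 ⟨x, hx⟩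
  let l : Jacobson K →ₗ[K] K := l1 ∘ₗ LinearMap.mulLeft K (1 - Yg K * Xg K)
  have hlap : ∀ x, l x = l1 ((1 - Yg K * Xg K) * x) := fun _ => rfl
  have hl : ∀ x, l (Yg K * x) = 0 := by
    intro x
    rw [hlap, ← mul_assoc, sub_mul, mul_assoc (Yg K), Xg_mul_Yg]
    simp
  have hm := serMap_mul K φ hX hY l hl
  refine ⟨{ toFun := serMap K l, map_add' := map_add _, map_smul' := fun r x => hm r x }, ?_⟩
  intro x hx
  funext n
  change l (Xg K ^ n * x) = _
  have hxn : Xg K ^ n * x ∈ I := I.mul_mem_left _ hx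
  have h3 : ((1 - Yg K * Xg K) * (Xg K ^ n * x)) ∈ I := I.mul_mem_left _ hxn
  rw [hlap, hl1' _ h3]
  have h4 := g.map_smul ((1 - Yg K * Xg K) * Xg K ^ n) ⟨x, hx⟩
  have e : (⟨_, h3⟩ : I) = ((1 - Yg K * Xg K) * Xg K ^ n) • ⟨x, hx⟩ := by
    apply Subtype.ext
    exact (mul_assoc _ _ _).symm
  rw [e, h4, hs, map_mul, map_sub, map_mul, map_pow, map_one, hX, hY,
    Module.End.mul_apply, LinearMap.sub_apply, Pi.sub_apply, Module.End.one_apply, Lsh_pow_apply,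
    Module.End.mul_apply]
  exact sub_zero _

/-- There is a (unique) `K`-algebra homomorphism `φ : R → End_K(ℕ → K)` with `φ X = L`
and `φ Y = S`, and for any such `φ`, the module `ℕ → K` of formal series, with the left
`R`-module structure induced by `φ`, is an injective left module over the Jacobson
algebra `R`. -/
theorem formal_series_module_injective :
    (∃ φ : Jacobson K →ₐ[K] Module.End K (ℕ → K), φ (Xg K) = Lsh K ∧ φ (Yg K) = Ssh K) ∧
      ∀ φ : Jacobson K →ₐ[K] Module.End K (ℕ → K), φ (Xg K) = Lsh K → φ (Yg K) = Ssh K →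
        letI := moduleOfHom K φ
        Module.Injective (Jacobson K) (ℕ → K) := by
  refine ⟨existsHom K, fun φ hX hY => ?_⟩
  letI := moduleOfHom K φ
  exact Module.Baer.injective (baer_series K φ hX hY)
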